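/- Let m₊ ∈ ℤ ± 1/4 with m₊ > 1. Then the following exact identity holds in ℚ(q): ∏_{u ∈ r_e(m₊ − 1)} (1 − q^{A₊} u^{−1})(1 − q^{A₊} u) / ((1 − q^{A₊+1} u^{−1})(1 − q^{A₊+1} u)) = ((1 − q^{A₊ + ε₊})/(1 − q^{A₊ + 1 − ε₊}))^{e'} · ∏_{i=1}^{κ₊ − 2 + ε₊} (1 − q^{2i}) / (1 − q^{A₊ + 1 + 2i − ε₊}), where e' = 1 if ε₊ ≠ δ₊ and e' = 0 otherwise. (The trailing product telescopes the factors (1 − q²)(1 − q⁴) ⋯ (1 − q^{A₊ − 2 + ε₊}) over (1 − q^{A₊ + 3 − ε₊})(1 − q^{A₊ + 5 − ε₊}) ⋯ (1 − q^{2A₊ − 1}); the left-hand side is the factor (P3) in the rank-zero extra-special computation.) -/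

import Mathlib

/-!
STATEMENT 9. The factor `(P3)` of the rank-zero extra-special computation:
`∏_{u ∈ r_e(m₊-1)} (1-q^{A₊}u⁻¹)(1-q^{A₊}u)/((1-q^{A₊+1}u⁻¹)(1-q^{A₊+1}u))
 = ((1-q^{A₊+ε₊})/(1-q^{A₊+1-ε₊}))^{e'} · ∏_{i=1}^{κ₊-2+ε₊} (1-q^{2i})/(1-q^{A₊+1+2i-ε₊})`
with `e' = 1` iff `ε₊ ≠ δ₊`.  Note `m₊ - 1` has `κ(m₊-1) = κ₊ - 1` and `ε(m₊-1) = ε₊`.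
-/

noncomputable section

/-- The field `ℚ(q)`. -/
abbrev RF9 : Type := RatFunc ℚ

/-- The indeterminate `q`. -/
def qR : RF9 := RatFunc.X

/-- Exponents of the coordinates of `σ_e(m)` for `m = κ + (2ε-1)/4`:
the integers from `δ(m) = κ % 2` to `A(m) = 2κ - 2 + ε`. -/
def sigmaExp (ε κ : ℕ) : Multiset ℤ := (Finset.Icc ((κ : ℤ) % 2) (2 * (κ : ℤ) - 2 + ε)).val

/-- Exponents of the coordinates of `r_e(m)` for `m = κ + (2ε-1)/4`. -/
def reExp (ε : ℕ) : ℕ → Multiset ℤ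
  | 0 => 0
  | κ + 1 => sigmaExp ε (κ + 1) + reExp ε κ

/-- A nonzero power of the indeterminate differs from `1`. -/
lemma one_sub_qR_zpow_ne_zero {n : ℤ} (hn : n ≠ 0) : (1 : RF9) - qR ^ n ≠ 0 := by
  have key (m : ℕ) (hm : m ≠ 0) : (qR : RF9) ^ m ≠ 1 := by
    intro h
    have h' : algebraMap (Polynomial ℚ) RF9 (Polynomial.X ^ m) = algebraMap _ _ 1 := by
      simpa [qR, RatFunc.algebraMap_X] using h
    have h2 := congrArg Polynomial.natDegree (RatFunc.algebraMap_injective ℚ h')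
    simp at h2
    exact hm h2
  rw [sub_ne_zero]
  intro h
  obtain ⟨m, rfl | rfl⟩ := n.eq_nat_or_neg
  · exact key m (by simpa using hn) (by simpa using h.symm)
  · exact key m (by simpa using hn) (by simpa [eq_comm] using h)

lemma qR_ne_zero : qR ≠ 0 := RatFunc.X_ne_zero

/-- The factor attached to the coordinate `u = q ^ e`. -/
def coordFactor (A e : ℤ) : RF9 :=
  (1 - qR ^ A * (qR ^ e)⁻¹) * (1 - qR ^ A * qR ^ e) /
    ((1 - qR ^ (A + 1) * (qR ^ e)⁻¹) * (1 - qR ^ (A + 1) * qR ^ e))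

lemma coordFactor_eq (A e : ℤ) : coordFactor A e =
    (1 - qR ^ (A - e)) * (1 - qR ^ (A + e)) /
      ((1 - qR ^ (A + 1 - e)) * (1 - qR ^ (A + 1 + e))) := by
  simp only [coordFactor, zpow_sub₀ qR_ne_zero _ e, zpow_add₀ qR_ne_zero _ e, div_eq_mul_inv]

/-- The product of the factors over an interval of exponents telescopes. -/
lemma prod_coordFactor_Icc {A d : ℤ} (hA : 0 < A) (hd : 0 ≤ d) (n : ℕ) (hn : d + n - 1 < A) :
    ∏ e ∈ Finset.Icc d (d + n - 1), coordFactor A e =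
      (1 - qR ^ (A + 1 - d - n)) * (1 - qR ^ (A + d)) /
        ((1 - qR ^ (A + 1 - d)) * (1 - qR ^ (A + d + n))) := by
  induction n with
  | zero =>
    have h1 := one_sub_qR_zpow_ne_zero (n := A + 1 - d) (by push_cast at hn; omega)
    have h2 := one_sub_qR_zpow_ne_zero (n := A + d) (by omega)
    simp [div_self (mul_ne_zero h1 h2)]
  | succ n ih =>
    push_cast at hn
    have hI : Finset.Icc d (d + (n + 1 : ℕ) - 1) = insert (d + n) (Finset.Icc d (d + n - 1)) := by
      ext x
      simp only [Finset.mem_Icc, Finset.mem_insert]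
      omega
    have h1 := one_sub_qR_zpow_ne_zero (n := A + 1 - d) (by omega)
    have h2 := one_sub_qR_zpow_ne_zero (n := A + d + n) (by omega)
    have h3 := one_sub_qR_zpow_ne_zero (n := A + 1 - d - n) (by omega)
    have h4 := one_sub_qR_zpow_ne_zero (n := A + d + (n + 1 : ℕ)) (by omega)
    rw [hI, Finset.prod_insert (by simp), ih (by omega), coordFactor_eq,
      show A - (d + n) = A + 1 - d - (n + 1 : ℕ) by push_cast; ring,
      show A + (d + n) = A + d + n by ring,
      show A + 1 - (d + n) = A + 1 - d - n by ring,
      show A + 1 + (d + n) = A + d + (n + 1 : ℕ) by push_cast; ring]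
    field_simp

/-- The product of the factors over all coordinates of `r_e`. -/
lemma prod_coordFactor_reExp {A : ℤ} (hA : 0 < A) (ε K : ℕ) (hK : 2 * (K : ℤ) - 2 + ε < A) :
    ((reExp ε K).map (coordFactor A)).prod =
      (if K % 2 = 0 then 1 else (1 - qR ^ (A + 1)) / (1 - qR ^ A)) *
        ∏ k ∈ Finset.range K,
          (1 - qR ^ (A - ε - 2 * (k : ℤ))) / (1 - qR ^ (A + 1 + ε + 2 * (k : ℤ))) := by
  induction K with
  | zero => simp [reExp]
  | succ K ih =>
    push_cast at hK
    have hσ : ((sigmaExp ε (K + 1)).map (coordFactor A)).prod =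
        (1 - qR ^ (A - ε - 2 * (K : ℤ))) * (1 - qR ^ (A + ((K : ℤ) + 1) % 2)) /
          ((1 - qR ^ (A + 1 - ((K : ℤ) + 1) % 2)) * (1 - qR ^ (A + 1 + ε + 2 * (K : ℤ)))) := by
      have hn : (0 : ℤ) ≤ 2 * K + ε + 1 - ((K : ℤ) + 1) % 2 := by omega
      have h := prod_coordFactor_Icc hA (d := ((K : ℤ) + 1) % 2) (by omega)
        (2 * K + ε + 1 - ((K : ℤ) + 1) % 2).toNat (by omega)
      rw [Int.toNat_of_nonneg hn] at h
      convert h using 1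
      · simp only [sigmaExp, Finset.prod]
        congr 4
        push_cast
        ring
      · congr 4 <;> ring
    rw [reExp, Multiset.map_add, Multiset.prod_add, hσ, ih (by omega), Finset.prod_range_succ]
    have h1 := one_sub_qR_zpow_ne_zero (n := A) (by omega)
    have h2 := one_sub_qR_zpow_ne_zero (n := A + 1) (by omega)
    rcases Nat.mod_two_eq_zero_or_one K with h | h
    · rw [if_pos h, if_neg (by omega), show ((K : ℤ) + 1) % 2 = 1 by omega, add_sub_cancel_right]
      field_simp
    · rw [if_neg (by omega), if_pos (by omega), show ((K : ℤ) + 1) % 2 = 0 by omega, add_zero,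
        sub_zero]
      field_simp

/-- Reversing the order of the numerators in a product of quotients. -/
lemma prod_range_div_reflect (f g : ℤ → RF9) (K : ℕ) (B : ℤ) (hB : B = 2 * K) :
    ∏ k ∈ Finset.range K, f (B - 2 * (k : ℤ)) / g k =
      (∏ k ∈ Finset.range K, f (2 * ((k : ℤ) + 1))) / ∏ k ∈ Finset.range K, g k := by
  rw [Finset.prod_div_distrib]
  congr 1
  rw [← Finset.prod_range_reflect]
  refine Finset.prod_congr rfl fun k hk => ?_
  rw [Finset.mem_range] at hk
  congr 1
  omega

theorem statement9 (κp εp δp : ℕ) (hεp : εp = 0 ∨ εp = 1) (hδp : δp = κp % 2)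
    (mplus : ℚ) (hmp : mplus = κp + (2 * (εp : ℚ) - 1) / 4) (h1 : 1 < mplus)
    (A : ℤ) (hA : A = 2 * (κp : ℤ) - 2 + εp) :
    ((reExp εp (κp - 1)).map fun e =>
        (1 - qR ^ A * (qR ^ e)⁻¹) * (1 - qR ^ A * qR ^ e) /
          ((1 - qR ^ (A + 1) * (qR ^ e)⁻¹) * (1 - qR ^ (A + 1) * qR ^ e))).prod =
      ((1 - qR ^ (A + εp)) / (1 - qR ^ (A + 1 - εp))) ^ (if εp = δp then 0 else 1) *
        ∏ i ∈ Finset.Icc 1 (κp + εp - 2),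
          (1 - qR ^ (2 * (i : ℤ))) / (1 - qR ^ (A + 1 + 2 * (i : ℤ) - εp)) := by
  change ((reExp εp (κp - 1)).map (coordFactor A)).prod = _
  have hIcc (g : ℕ → RF9) (n : ℕ) : ∏ i ∈ Finset.Icc 1 n, g i = ∏ i ∈ Finset.range n, g (i + 1) := by
    rw [Finset.range_eq_Ico, Finset.prod_Ico_add' g 0 n 1]
    rfl
  rcases hεp with rfl | rfl
  · have hκ : 2 ≤ κp := by
      by_contra! h
      have : (κp : ℚ) ≤ 1 := by exact_mod_cast Nat.le_of_lt_succ h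
      push_cast at hmp
      linarith
    obtain ⟨n, rfl⟩ := Nat.exists_eq_add_of_le' hκ
    have h1 := one_sub_qR_zpow_ne_zero (n := A) (by omega)
    have h2 := one_sub_qR_zpow_ne_zero (n := A + 1) (by omega)
    rw [prod_coordFactor_reExp (by omega) 0 _ (by omega), hIcc,
      prod_range_div_reflect (fun x => 1 - qR ^ (x : ℤ))
        (fun k => 1 - qR ^ (A + 1 + (0 : ℕ) + 2 * k)) _ _ (by omega),
      Finset.prod_div_distrib]
    simp only [show n + 2 - 1 = n + 1 by omega, show n + 2 + 0 - 2 = n by omega]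
    rw [Finset.prod_range_succ, Finset.prod_range_succ' (fun k : ℕ => _ - qR ^ (A + 1 + _ + _))]
    simp only [Nat.cast_add, Nat.cast_one, Nat.cast_zero, add_zero, mul_zero, sub_zero]
    rw [show 2 * ((n : ℤ) + 1) = A by push_cast at hA; omega]
    rcases Nat.mod_two_eq_zero_or_one n with h | h
    · rw [if_neg (by omega), if_pos (by omega)]
      field_simp
    · rw [if_pos (by omega), if_neg (by omega)]
      field_simp
  · have hκ : 1 ≤ κp := by
      by_contra! h
      obtain rfl : κp = 0 := by omega
      norm_num at hmp
      linarith
    obtain ⟨n, rfl⟩ := Nat.exists_eq_add_of_le' hκ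
    rw [prod_coordFactor_reExp (by omega) 1 _ (by omega), hIcc,
      prod_range_div_reflect (fun x => 1 - qR ^ (x : ℤ))
        (fun k => 1 - qR ^ (A + 1 + (1 : ℕ) + 2 * k)) _ _ (by omega),
      Finset.prod_div_distrib]
    simp only [show n + 1 - 1 = n by omega, show n + 1 + 1 - 2 = n by omega]
    congr 1
    · rcases Nat.mod_two_eq_zero_or_one n with h | h
      · rw [if_pos h, if_pos (by omega), pow_zero]
      · rw [if_neg (by omega), if_neg (by omega), pow_one]
        simp
    · push_cast
      congr 1
      refine Finset.prod_congr rfl fun k _ => ?_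
      congr 2
      ring
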